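/- arXiv:1308.2136 — 6 statements merged into one kernel-verified Lean document; each statement's English description precedes it below -/
import Mathlib

section
/- Let f and ν be as in the context, and suppose p is a rank-one singular point of f in admissible coordinates, i.e. f_v(p) = 0 and f_u(p) ≠ 0, and suppose f is a front at p, i.e. ∂_v ν(p) ≠ 0. Then the following three conditions are equivalent: (1) the limiting normal curvature κ_ν(p) := ⟨f_uu(p), ν(p)⟩/‖f_u(p)‖² is equal to zero; (2) det(∂_u ν(p), ∂_v ν(p), ν(p)) = 0 (the 2-form K dÂ, which equals the pull-back by ν of the area element of the unit sphere, vanishes at p); (3) the Gauss map ν is singular at p, i.e. ∂_u ν(p) and ∂_v ν(p) are linearly dependent. -/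
open scoped RealInnerProductSpace
open Filter

noncomputable section

/-- Euclidean 3-space. -/
abbrev E3 : Type := EuclideanSpace ℝ (Fin 3)

/-- Partial derivative in the first (`u`) direction. -/
def pu {E : Type*} [NormedAddCommGroup E] [NormedSpace ℝ E] (f : ℝ × ℝ → E) (q : ℝ × ℝ) : E :=
  fderiv ℝ f q (1, 0)

/-- Partial derivative in the second (`v`) direction. -/
def pv {E : Type*} [NormedAddCommGroup E] [NormedSpace ℝ E] (f : ℝ × ℝ → E) (q : ℝ × ℝ) : E :=
  fderiv ℝ f q (0, 1)

/-- Determinant of three column vectors in `ℝ³`. -/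
def det3 (a b c : E3) : ℝ :=
  Matrix.det !![a 0, b 0, c 0; a 1, b 1, c 1; a 2, b 2, c 2]

/-- Cross product in `ℝ³`. -/
def cross3 (a b : E3) : E3 :=
  (WithLp.equiv 2 (Fin 3 → ℝ)).symm
    ![a 1 * b 2 - a 2 * b 1, a 2 * b 0 - a 0 * b 2, a 0 * b 1 - a 1 * b 0]

theorem inner_eq_sum_coord (a b : E3) : ⟪a, b⟫ = a 0 * b 0 + a 1 * b 1 + a 2 * b 2 := by
  simp [PiLp.inner_apply, Fin.sum_univ_three, mul_comm]

theorem det3_mul_det3 (a b c x y z : E3) :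
    det3 a b c * det3 x y z =
      Matrix.det !![⟪a, x⟫, ⟪a, y⟫, ⟪a, z⟫; ⟪b, x⟫, ⟪b, y⟫, ⟪b, z⟫; ⟪c, x⟫, ⟪c, y⟫, ⟪c, z⟫] := by
  simp only [det3, inner_eq_sum_coord, Matrix.det_fin_three, Matrix.of_apply, Matrix.cons_val]
  ring

theorem eq_zero_of_inner_eq_zero_of_det3_ne_zero {a b c w : E3} (h : det3 a b c ≠ 0)
    (ha : ⟪w, a⟫ = 0) (hb : ⟪w, b⟫ = 0) (hc : ⟪w, c⟫ = 0) : w = 0 := by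
  simp only [inner_eq_sum_coord] at ha hb hc
  simp only [det3, Matrix.det_fin_three, Matrix.of_apply, Matrix.cons_val] at h
  ext i
  refine (mul_eq_zero.mp ?_).resolve_left h
  fin_cases i <;> simp only [Fin.zero_eta, Fin.mk_one, Fin.reduceFinMk]
  · linear_combination (b 1 * c 2 - b 2 * c 1) * ha + (c 1 * a 2 - c 2 * a 1) * hb +
      (a 1 * b 2 - a 2 * b 1) * hc
  · linear_combination (b 2 * c 0 - b 0 * c 2) * ha + (c 2 * a 0 - c 0 * a 2) * hb +
      (a 2 * b 0 - a 0 * b 2) * hc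
  · linear_combination (b 0 * c 1 - b 1 * c 0) * ha + (c 0 * a 1 - c 1 * a 0) * hb +
      (a 0 * b 1 - a 1 * b 0) * hc

section OrthogonalFrame

variable {a b n x : E3}

theorem det3_ne_zero_of_orthogonal (hn : ‖n‖ = 1) (hb : b ≠ 0) (hx : x ≠ 0)
    (hbn : ⟪b, n⟫ = 0) (hxn : ⟪x, n⟫ = 0) (hbx : ⟪b, x⟫ = 0) : det3 x b n ≠ 0 := by
  have h := det3_mul_det3 x b n x b n
  simp only [Matrix.det_fin_three, Matrix.of_apply, Matrix.cons_val, hbn, hxn, hbx,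
    real_inner_self_eq_norm_sq, hn] at h
  intro h0
  rw [h0] at h
  have : ‖x‖ ^ 2 * ‖b‖ ^ 2 = 0 := by linear_combination -h
  simp [hb, hx] at this

theorem inner_eq_zero_iff_det3_eq_zero (hn : ‖n‖ = 1) (hb : b ≠ 0) (hx : x ≠ 0)
    (hbn : ⟪b, n⟫ = 0) (hxn : ⟪x, n⟫ = 0) (hbx : ⟪b, x⟫ = 0) (han : ⟪a, n⟫ = 0) :
    ⟪a, x⟫ = 0 ↔ det3 a b n = 0 := by
  have hdet := det3_ne_zero_of_orthogonal hn hb hx hbn hxn hbx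
  have h : det3 a b n * det3 x b n = ⟪a, x⟫ * ‖b‖ ^ 2 := by
    rw [det3_mul_det3]
    simp only [Matrix.det_fin_three, Matrix.of_apply, Matrix.cons_val,
      real_inner_self_eq_norm_sq, hn, han, hbn, hbx]
    ring
  have hb' : ‖b‖ ^ 2 ≠ 0 := by simpa using hb
  rw [← mul_eq_zero_iff_right hb', ← h, mul_eq_zero_iff_right hdet]

theorem inner_eq_zero_iff_not_linearIndependent (hn : ‖n‖ = 1) (hb : b ≠ 0) (hx : x ≠ 0)
    (hbn : ⟪b, n⟫ = 0) (hxn : ⟪x, n⟫ = 0) (hbx : ⟪b, x⟫ = 0) (han : ⟪a, n⟫ = 0) :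
    ⟪a, x⟫ = 0 ↔ ¬ LinearIndependent ℝ ![a, b] := by
  rw [LinearIndependent.pair_symm_iff, LinearIndependent.pair_iff' hb]
  push Not
  constructor
  · intro hax
    refine ⟨⟪a, b⟫ / ‖b‖ ^ 2, (sub_eq_zero.mp ?_).symm⟩
    have hb' : ‖b‖ ^ 2 ≠ 0 := by simpa using hb
    apply eq_zero_of_inner_eq_zero_of_det3_ne_zero
      (det3_ne_zero_of_orthogonal hn hb hx hbn hxn hbx)
    · simp [inner_sub_left, real_inner_smul_left, hax, hbx]
    · rw [inner_sub_left, real_inner_smul_left, real_inner_self_eq_norm_sq]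
      field_simp
      ring
    · simp [inner_sub_left, real_inner_smul_left, han, hbn]
  · rintro ⟨c, rfl⟩
    simp [real_inner_smul_left, hbx]

end OrthogonalFrame

theorem inner_fderiv_add_eq_zero_of_eventually_const {g h : ℝ × ℝ → E3} {p : ℝ × ℝ} {c : ℝ}
    (hg : DifferentiableAt ℝ g p) (hh : DifferentiableAt ℝ h p)
    (hc : ∀ᶠ q in nhds p, ⟪g q, h q⟫ = c) (w : ℝ × ℝ) :
    ⟪g p, fderiv ℝ h p w⟫ + ⟪fderiv ℝ g p w, h p⟫ = 0 := by
  rw [← fderiv_inner_apply ℝ hg hh, Filter.EventuallyEq.fderiv_eq (f := fun _ => c) hc]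
  simp

theorem two_le_coe_top : (2 : WithTop ℕ∞) ≤ (⊤ : ℕ∞) :=
  WithTop.coe_le_coe.mpr (le_top : (2 : ℕ∞) ≤ ⊤)

theorem fderiv_fderiv_apply {f : ℝ × ℝ → E3} (hf : ContDiff ℝ (⊤ : ℕ∞) f) (p w z : ℝ × ℝ) :
    DifferentiableAt ℝ (fun q => fderiv ℝ f q w) p ∧
      fderiv ℝ (fun q => fderiv ℝ f q w) p z = fderiv ℝ (fderiv ℝ f) p z w := by
  have h : DifferentiableAt ℝ (fderiv ℝ f) p :=
    (hf.fderiv_right (m := 1) (one_add_one_eq_two.trans_le two_le_coe_top)).differentiable (by simp) p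
  refine ⟨h.clm_apply (differentiableAt_const w), ?_⟩
  rw [fderiv_clm_apply h (differentiableAt_const w)]
  simp

theorem pv_pu_eq_pu_pv {f : ℝ × ℝ → E3} (hf : ContDiff ℝ (⊤ : ℕ∞) f) (p : ℝ × ℝ) :
    pv (pu f) p = pu (pv f) p := by
  have hsymm : IsSymmSndFDerivAt ℝ f p :=
    hf.contDiffAt.isSymmSndFDerivAt (by simpa using two_le_coe_top)
  calc pv (pu f) p = fderiv ℝ (fderiv ℝ f) p (0, 1) (1, 0) := (fderiv_fderiv_apply hf p _ _).2
    _ = fderiv ℝ (fderiv ℝ f) p (1, 0) (0, 1) := hsymm _ _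
    _ = pu (pv f) p := (fderiv_fderiv_apply hf p _ _).2.symm

/-- **Theorem A.** For a front `f` with unit normal `ν` at a rank-one singular point `p`
in admissible coordinates (`f_v(p) = 0`, `f_u(p) ≠ 0`), the vanishing of the limiting normal
curvature `κ_ν(p) = ⟨f_uu(p), ν(p)⟩/‖f_u(p)‖²` is equivalent to the vanishing of
`det(ν_u(p), ν_v(p), ν(p))` (the 2-form `K dÂ` at `p`), and is also equivalent to the
Gauss map `ν` being singular at `p`. -/
theorem limiting_normal_curvature_zero_iff
    (f ν : ℝ × ℝ → E3) (p : ℝ × ℝ)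
    (hf : ContDiff ℝ (⊤ : ℕ∞) f) (hν : ContDiff ℝ (⊤ : ℕ∞) ν)
    (hfrontal : ∀ᶠ q in nhds p, ‖ν q‖ = 1 ∧ ⟪ν q, pu f q⟫ = 0 ∧ ⟪ν q, pv f q⟫ = 0)
    (hsing : pv f p = 0) (hrank1 : pu f p ≠ 0)
    (hfront : pv ν p ≠ 0) :
    (⟪pu (pu f) p, ν p⟫ / ‖pu f p‖ ^ 2 = 0 ↔ det3 (pu ν p) (pv ν p) (ν p) = 0) ∧
    (⟪pu (pu f) p, ν p⟫ / ‖pu f p‖ ^ 2 = 0 ↔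
      ¬ LinearIndependent ℝ ![pu ν p, pv ν p]) := by
  have hνd : DifferentiableAt ℝ ν p := hν.differentiable (by simp) p
  have hud : DifferentiableAt ℝ (pu f) p := (fderiv_fderiv_apply hf p (1, 0) 0).1
  have hvd : DifferentiableAt ℝ (pv f) p := (fderiv_fderiv_apply hf p (0, 1) 0).1
  obtain ⟨hn, hnu, -⟩ := hfrontal.self_of_nhds
  have hself (w : ℝ × ℝ) : ⟪fderiv ℝ ν p w, ν p⟫ = 0 := by
    have h := inner_fderiv_add_eq_zero_of_eventually_const (c := 1) hνd hνd
      (hfrontal.mono fun q hq => by simp [hq.1]) w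
    rw [real_inner_comm] at h
    linarith
  have huu : ⟪ν p, pu (pu f) p⟫ + ⟪pu ν p, pu f p⟫ = 0 :=
    inner_fderiv_add_eq_zero_of_eventually_const hνd hud (hfrontal.mono fun q hq => hq.2.1) (1, 0)
  have huv : ⟪ν p, pv (pu f) p⟫ + ⟪pv ν p, pu f p⟫ = 0 :=
    inner_fderiv_add_eq_zero_of_eventually_const hνd hud (hfrontal.mono fun q hq => hq.2.1) (0, 1)
  have hvu : ⟪ν p, pu (pv f) p⟫ + ⟪pu ν p, pv f p⟫ = 0 :=
    inner_fderiv_add_eq_zero_of_eventually_const hνd hvd (hfrontal.mono fun q hq => hq.2.2) (1, 0)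
  have hvx : ⟪pv ν p, pu f p⟫ = 0 := by
    rw [hsing, inner_zero_right, add_zero] at hvu
    rwa [pv_pu_eq_pu_pv hf, hvu, zero_add] at huv
  have hκ : ⟪pu (pu f) p, ν p⟫ / ‖pu f p‖ ^ 2 = 0 ↔ ⟪pu ν p, pu f p⟫ = 0 := by
    have hx : ‖pu f p‖ ^ 2 ≠ 0 := by simpa using hrank1
    rw [div_eq_zero_iff, or_iff_left hx, real_inner_comm, eq_neg_of_add_eq_zero_left huu,
      neg_eq_zero]
  have hun : ⟪pu f p, ν p⟫ = 0 := by rwa [real_inner_comm]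
  rw [hκ]
  exact ⟨inner_eq_zero_iff_det3_eq_zero hn hfront hrank1 (hself _) hun hvx (hself _),
    inner_eq_zero_iff_not_linearIndependent hn hfront hrank1 (hself _) hun hvx (hself _)⟩
end
end

section
/- Let f and ν be as in the context with f_v(p) = 0 and f_u(p) ≠ 0 (p is a rank-one singular point in admissible coordinates). Let φ : V → ℝ² be a C^∞ map on an open set V ⊆ ℝ² with φ(q) = p whose differential Dφ(q) is invertible, and set g := f ∘ φ. If ∂_v g(q) = 0, then ∂_u g(q) ≠ 0 and ⟨∂_u∂_u g(q), ν(p)⟩/‖∂_u g(q)‖² = ⟨f_uu(p), ν(p)⟩/‖f_u(p)‖²; that is, the limiting normal curvature κ_ν(p) does not depend on the choice of admissible coordinate system. -/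
open scoped RealInnerProductSpace
open Filter

noncomputable section

/-- Differentiating the relation `⟪N, h⟫ = 0`. -/
lemma inner_fderiv_eq_neg_of_eventually_inner_eq_zero {N h : ℝ × ℝ → E3} {x : ℝ × ℝ}
    (hN : DifferentiableAt ℝ N x) (hh : DifferentiableAt ℝ h x)
    (h0 : ∀ᶠ y in nhds x, ⟪N y, h y⟫ = 0) (w : ℝ × ℝ) :
    ⟪N x, fderiv ℝ h x w⟫ = -⟪fderiv ℝ N x w, h x⟫ := by
  have h1 : fderiv ℝ (fun y => ⟪N y, h y⟫) x = 0 := by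
    have : (fun y => ⟪N y, h y⟫) =ᶠ[nhds x] fun _ => (0 : ℝ) := h0
    rw [this.fderiv_eq, fderiv_fun_const, Pi.zero_apply]
  have h2 := fderiv_inner_apply ℝ hN hh w
  rw [h1, zero_apply] at h2
  linarith

lemma fderiv_apply_eq_pu_pv {E : Type*} [NormedAddCommGroup E] [NormedSpace ℝ E]
    (f : ℝ × ℝ → E) (x w : ℝ × ℝ) :
    fderiv ℝ f x w = w.1 • pu f x + w.2 • pv f x := by
  have hw : w = w.1 • ((1, 0) : ℝ × ℝ) + w.2 • ((0, 1) : ℝ × ℝ) := by ext <;> simp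
  conv_lhs => rw [hw, map_add, map_smul, map_smul]
  rfl

lemma pu_comp {E F : Type*} [NormedAddCommGroup E] [NormedSpace ℝ E] [NormedAddCommGroup F]
    [NormedSpace ℝ F] {f : E → F} {φ : ℝ × ℝ → E} {x : ℝ × ℝ}
    (hf : DifferentiableAt ℝ f (φ x)) (hφ : DifferentiableAt ℝ φ x) :
    pu (f ∘ φ) x = fderiv ℝ f (φ x) (pu φ x) := by
  simp only [pu, fderiv_comp x hf hφ, ContinuousLinearMap.comp_apply]

lemma pv_comp {E F : Type*} [NormedAddCommGroup E] [NormedSpace ℝ E] [NormedAddCommGroup F]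
    [NormedSpace ℝ F] {f : E → F} {φ : ℝ × ℝ → E} {x : ℝ × ℝ}
    (hf : DifferentiableAt ℝ f (φ x)) (hφ : DifferentiableAt ℝ φ x) :
    pv (f ∘ φ) x = fderiv ℝ f (φ x) (pv φ x) := by
  simp only [pv, fderiv_comp x hf hφ, ContinuousLinearMap.comp_apply]

/-- Mixed partial derivatives commute. -/
lemma pu_pv_comm {E : Type*} [NormedAddCommGroup E] [NormedSpace ℝ E] {f : ℝ × ℝ → E}
    (hf : ContDiff ℝ 2 f) (x : ℝ × ℝ) : pu (pv f) x = pv (pu f) x := by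
  have hd : DifferentiableAt ℝ (fderiv ℝ f) x :=
    (hf.fderiv_right (m := 1) (by norm_num)).differentiable (by norm_num) x
  have key (a b : ℝ × ℝ) :
      fderiv ℝ (fun y => fderiv ℝ f y a) x b = fderiv ℝ (fderiv ℝ f) x b a := by
    rw [fderiv_clm_apply hd (differentiableAt_const a)]
    simp
  have hs : IsSymmSndFDerivAt ℝ f x := hf.contDiffAt.isSymmSndFDerivAt (by simp)
  exact (key _ _).trans ((hs _ _).trans (key _ _).symm)

/-- The limiting normal curvature does not depend on the choice of admissible
coordinate system: if `φ` is a local diffeomorphism with `φ(q) = p` and `g = f ∘ φ` also has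
admissible coordinates at `q` (i.e. `g_v(q) = 0`), then `g_u(q) ≠ 0` and
`⟨g_uu(q), ν(p)⟩/‖g_u(q)‖² = ⟨f_uu(p), ν(p)⟩/‖f_u(p)‖²`. -/
theorem limiting_normal_curvature_well_defined
    (f ν : ℝ × ℝ → E3) (p q : ℝ × ℝ) (V : Set (ℝ × ℝ)) (φ : ℝ × ℝ → ℝ × ℝ)
    (hf : ContDiff ℝ (⊤ : ℕ∞) f) (hν : ContDiff ℝ (⊤ : ℕ∞) ν)
    (hfrontal : ∀ᶠ x in nhds p, ‖ν x‖ = 1 ∧ ⟪ν x, pu f x⟫ = 0 ∧ ⟪ν x, pv f x⟫ = 0)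
    (hsing : pv f p = 0) (hrank1 : pu f p ≠ 0)
    (hV : IsOpen V) (hq : q ∈ V) (hφ : ContDiffOn ℝ (⊤ : ℕ∞) φ V) (hφq : φ q = p)
    (hD : Function.Bijective (fderiv ℝ φ q))
    (hgv : pv (f ∘ φ) q = 0) :
    pu (f ∘ φ) q ≠ 0 ∧
      ⟪pu (pu (f ∘ φ)) q, ν p⟫ / ‖pu (f ∘ φ) q‖ ^ 2 =
        ⟪pu (pu f) p, ν p⟫ / ‖pu f p‖ ^ 2 := by
  have hφ' : ContDiffAt ℝ (⊤ : ℕ∞) φ q := hφ.contDiffAt (hV.mem_nhds hq)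
  have hφd : DifferentiableAt ℝ φ q := hφ'.differentiableAt (by simp)
  have hfd : Differentiable ℝ f := hf.differentiable (by simp)
  have hνd : Differentiable ℝ ν := hν.differentiable (by simp)
  have hf2 : ContDiff ℝ 2 f := contDiff_infty.mp hf 2
  have hf' : ContDiff ℝ 1 (fderiv ℝ f) := hf2.fderiv_right (by norm_num)
  have hfud : Differentiable ℝ (pu f) :=
    (hf'.clm_apply contDiff_const).differentiable (by norm_num)
  have hfvd : Differentiable ℝ (pv f) :=
    (hf'.clm_apply contDiff_const).differentiable (by norm_num)
  have hνu : ∀ᶠ x in nhds p, ⟪ν x, pu f x⟫ = 0 := hfrontal.mono fun _ h => h.2.1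
  have hνv : ∀ᶠ x in nhds p, ⟪ν x, pv f x⟫ = 0 := hfrontal.mono fun _ h => h.2.2
  have hνv_fu : ⟪pv ν p, pu f p⟫ = 0 := by
    have h1 : ⟪ν p, pu (pv f) p⟫ = -⟪pu ν p, pv f p⟫ :=
      inner_fderiv_eq_neg_of_eventually_inner_eq_zero (hνd p) (hfvd p) hνv (1, 0)
    have h2 : ⟪ν p, pv (pu f) p⟫ = -⟪pv ν p, pu f p⟫ :=
      inner_fderiv_eq_neg_of_eventually_inner_eq_zero (hνd p) (hfud p) hνu (0, 1)
    rw [pu_pv_comm hf2, h2, hsing, inner_zero_right] at h1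
    linarith
  have hfuu : ⟪ν p, pu (pu f) p⟫ = -⟪pu ν p, pu f p⟫ :=
    inner_fderiv_eq_neg_of_eventually_inner_eq_zero (hνd p) (hfud p) hνu (1, 0)
  have hgu : pu (f ∘ φ) q = (pu φ q).1 • pu f p := by
    rw [pu_comp (hfd _) hφd, hφq, fderiv_apply_eq_pu_pv, hsing, smul_zero, add_zero]
  have hc : (pv φ q).1 = 0 := by
    rw [pv_comp (hfd _) hφd, hφq, fderiv_apply_eq_pu_pv, hsing, smul_zero, add_zero] at hgv
    exact (smul_eq_zero.mp hgv).resolve_right hrank1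
  have ha : (pu φ q).1 ≠ 0 := by
    intro ha
    obtain ⟨w, hw⟩ := hD.2 (1, 0)
    rw [fderiv_apply_eq_pu_pv] at hw
    simpa [ha, hc] using congrArg Prod.fst hw
  have hg0 : ∀ᶠ y in nhds q, ⟪(ν ∘ φ) y, pu (f ∘ φ) y⟫ = 0 := by
    have ht : Tendsto φ (nhds q) (nhds p) := hφq ▸ hφd.continuousAt
    filter_upwards [ht.eventually hνu, ht.eventually hνv, hV.mem_nhds hq] with y hu hv hy
    have hyd : DifferentiableAt ℝ φ y :=
      (hφ.contDiffAt (hV.mem_nhds hy)).differentiableAt (by simp)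
    rw [pu_comp (hfd _) hyd, fderiv_apply_eq_pu_pv, inner_add_right, inner_smul_right,
      inner_smul_right, Function.comp_apply, hu, hv]
    simp
  have hgud : DifferentiableAt ℝ (pu (f ∘ φ)) q := by
    have hg : ContDiffAt ℝ 2 (f ∘ φ) q := hf2.contDiffAt.comp q (contDiffAt_infty.mp hφ' 2)
    have hg' : ContDiffAt ℝ 1 (fderiv ℝ (f ∘ φ)) q :=
      hg.fderiv_right (by norm_num)
    exact (hg'.clm_apply contDiffAt_const).differentiableAt (by norm_num)
  have hguu : ⟪ν p, pu (pu (f ∘ φ)) q⟫ = -⟪pu (ν ∘ φ) q, pu (f ∘ φ) q⟫ := by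
    have := inner_fderiv_eq_neg_of_eventually_inner_eq_zero
      ((hνd (φ q)).comp q hφd) hgud hg0 (1, 0)
    rwa [Function.comp_apply, hφq] at this
  have hscale : ⟪ν p, pu (pu (f ∘ φ)) q⟫ = (pu φ q).1 ^ 2 * ⟪ν p, pu (pu f) p⟫ := by
    rw [hguu, hfuu, hgu, pu_comp (hνd _) hφd, hφq, fderiv_apply_eq_pu_pv, inner_smul_right,
      inner_add_left, real_inner_smul_left, real_inner_smul_left, hνv_fu]
    ring
  refine ⟨hgu ▸ smul_ne_zero ha hrank1, ?_⟩
  rw [real_inner_comm, hscale, hgu, norm_smul, mul_pow, Real.norm_eq_abs, sq_abs,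
    mul_div_mul_left _ _ (pow_ne_zero 2 ha), real_inner_comm]
end
end

section
/- Let f and ν be as in the context, and let γ : (−δ, δ) → ℝ² be a C^∞ curve with γ(0) = p such that f_v(γ(t)) = 0 and ‖f_u(γ(t))‖ = 1 for all t, and such that γ̂'(t) ≠ 0 for all t ≠ 0, where γ̂ := f ∘ γ. Then the limiting normal curvature is continuous along the singular curve: lim_{t→0} ⟨γ̂''(t), ν(γ(t))⟩/‖γ̂'(t)‖² = ⟨f_uu(p), ν(p)⟩. -/
open scoped RealInnerProductSpace
open Filter

noncomputable section

lemma contDiff_fderiv_apply_const {E F : Type*} [NormedAddCommGroup E] [NormedSpace ℝ E]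
    [NormedAddCommGroup F] [NormedSpace ℝ F] {f : E → F} (hf : ContDiff ℝ (⊤ : ℕ∞) f) (w : E) :
    ContDiff ℝ (⊤ : ℕ∞) (fun q => fderiv ℝ f q w) :=
  (hf.fderiv_right (by simp)).clm_apply contDiff_const

/-- Mixed partial derivatives of a smooth map commute. -/
lemma pv_pu_eq_pu_pv_s2 {E : Type*} [NormedAddCommGroup E] [NormedSpace ℝ E] {f : ℝ × ℝ → E}
    (hf : ContDiff ℝ (⊤ : ℕ∞) f) (q : ℝ × ℝ) : pv (pu f) q = pu (pv f) q := by
  have hd : DifferentiableAt ℝ (fderiv ℝ f) q :=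
    ((hf.fderiv_right (m := (⊤ : ℕ∞)) (by simp)).differentiable (by simp)) q
  have hsymm : IsSymmSndFDerivAt ℝ f q := hf.contDiffAt.isSymmSndFDerivAt
    (by simpa using WithTop.coe_le_coe.2 (le_top : (2 : ℕ∞) ≤ ⊤))
  have happ (w w' : ℝ × ℝ) :
      fderiv ℝ (fun x => fderiv ℝ f x w) q w' = fderiv ℝ (fderiv ℝ f) q w' w := by
    rw [fderiv_clm_apply hd (by fun_prop)]
    simp
  change fderiv ℝ (fun x => fderiv ℝ f x (1, 0)) q (0, 1)
    = fderiv ℝ (fun x => fderiv ℝ f x (0, 1)) q (1, 0)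
  rw [happ, happ]
  exact hsymm _ _

lemma fderiv_apply_eq_smul_pu_add_smul_pv {E : Type*} [NormedAddCommGroup E] [NormedSpace ℝ E]
    (f : ℝ × ℝ → E) (q w : ℝ × ℝ) : fderiv ℝ f q w = w.1 • pu f q + w.2 • pv f q := by
  rw [pu, pv, ← map_smul, ← map_smul, ← map_add]
  simp

/-- The velocity of the image of a singular curve is a multiple of `f_u`. -/
lemma deriv_comp_eq_smul_pu {E : Type*} [NormedAddCommGroup E] [NormedSpace ℝ E]
    {f : ℝ × ℝ → E} {γ : ℝ → ℝ × ℝ} {t : ℝ} (hf : DifferentiableAt ℝ f (γ t))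
    (hγ : DifferentiableAt ℝ γ t) (hsing : pv f (γ t) = 0) :
    deriv (f ∘ γ) t = (deriv γ t).1 • pu f (γ t) := by
  rw [fderiv_comp_deriv t hf hγ, fderiv_apply_eq_smul_pu_add_smul_pv, hsing, smul_zero, add_zero]

/-- At a point where `f_v` vanishes, the mixed derivative of a frontal is tangent. -/
lemma inner_pv_pu_eq_zero {f ν : ℝ × ℝ → E3} {q : ℝ × ℝ}
    (hf : ContDiff ℝ (⊤ : ℕ∞) f) (hν : DifferentiableAt ℝ ν q)
    (horth : ∀ᶠ x in nhds q, ⟪ν x, pv f x⟫ = 0) (hq : pv f q = 0) :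
    ⟪ν q, pv (pu f) q⟫ = 0 := by
  have hpv : DifferentiableAt ℝ (pv f) q :=
    (contDiff_fderiv_apply_const hf _).differentiable (by simp) q
  have hzero : fderiv ℝ (fun x => ⟪ν x, pv f x⟫) q (1, 0) = 0 := by
    have : (fun x => ⟪ν x, pv f x⟫) =ᶠ[nhds q] fun _ => (0 : ℝ) := horth
    rw [this.fderiv_eq]
    simp
  rw [fderiv_inner_apply ℝ hν hpv, hq, inner_zero_right, add_zero] at hzero
  rw [pv_pu_eq_pu_pv_s2 hf]
  exact hzero

/-- Along a singular curve, the normal part of the acceleration is the normal part of `f_uu`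
scaled by the square of the speed in the `u` direction. -/
lemma inner_deriv_deriv_comp_eq {f ν : ℝ × ℝ → E3} {γ : ℝ → ℝ × ℝ} {t : ℝ}
    (hf : ContDiff ℝ (⊤ : ℕ∞) f) (hν : DifferentiableAt ℝ ν (γ t))
    (hγ : ContDiff ℝ (⊤ : ℕ∞) γ)
    (hpu : ⟪ν (γ t), pu f (γ t)⟫ = 0)
    (hpv : ∀ᶠ x in nhds (γ t), ⟪ν x, pv f x⟫ = 0)
    (hsing : ∀ᶠ s in nhds t, pv f (γ s) = 0) :
    ⟪deriv (deriv (f ∘ γ)) t, ν (γ t)⟫ =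
      (deriv γ t).1 ^ 2 * ⟪pu (pu f) (γ t), ν (γ t)⟫ := by
  have hvel : deriv (f ∘ γ) =ᶠ[nhds t] fun s => (deriv γ s).1 • pu f (γ s) := by
    filter_upwards [hsing] with s hs
    exact deriv_comp_eq_smul_pu (hf.differentiable (by simp) _)
      (hγ.differentiable (by simp) _) hs
  have hγd : DifferentiableAt ℝ γ t := hγ.differentiable (by simp) t
  have hpud : DifferentiableAt ℝ (pu f) (γ t) :=
    (contDiff_fderiv_apply_const hf _).differentiable (by simp) _
  have hspeed : DifferentiableAt ℝ (fun s => (deriv γ s).1) t :=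
    (((contDiff_infty_iff_deriv.1 hγ).2.differentiable (by simp)) t).fst
  have hacc : deriv (deriv (f ∘ γ)) t =
      (deriv γ t).1 • fderiv ℝ (pu f) (γ t) (deriv γ t) +
        deriv (fun s => (deriv γ s).1) t • pu f (γ t) := by
    rw [hvel.deriv_eq]
    exact (hspeed.hasDerivAt.smul
      (hpud.hasFDerivAt.comp_hasDerivAt t hγd.hasDerivAt)).deriv
  have hmixed : ⟪ν (γ t), pv (pu f) (γ t)⟫ = 0 :=
    inner_pv_pu_eq_zero hf hν hpv hsing.self_of_nhds
  rw [real_inner_comm] at hpu hmixed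
  rw [hacc, fderiv_apply_eq_smul_pu_add_smul_pv]
  simp only [inner_add_left, real_inner_smul_left, hpu, hmixed]
  ring

/-- **Continuity of the limiting normal curvature.** Along a singular curve `γ` through `p`
parameterized so that `f_v(γ(t)) = 0` and `‖f_u(γ(t))‖ = 1`, with `γ̂ = f ∘ γ` regular for
`t ≠ 0`, the normalized normal part `⟨γ̂''(t), ν(γ(t))⟩/‖γ̂'(t)‖²` tends to
`⟨f_uu(p), ν(p)⟩` as `t → 0`. -/
theorem limiting_normal_curvature_continuous
    (f ν : ℝ × ℝ → E3) (p : ℝ × ℝ) (γ : ℝ → ℝ × ℝ) (δ : ℝ)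
    (hf : ContDiff ℝ (⊤ : ℕ∞) f) (hν : ContDiff ℝ (⊤ : ℕ∞) ν)
    (hfrontal : ∀ᶠ x in nhds p, ‖ν x‖ = 1 ∧ ⟪ν x, pu f x⟫ = 0 ∧ ⟪ν x, pv f x⟫ = 0)
    (hγ : ContDiff ℝ (⊤ : ℕ∞) γ) (hγ0 : γ 0 = p) (hδ : 0 < δ)
    (hsing : ∀ t, |t| < δ → pv f (γ t) = 0)
    (hunit : ∀ t, |t| < δ → ‖pu f (γ t)‖ = 1)
    (hreg : ∀ t, t ≠ 0 → |t| < δ → deriv (f ∘ γ) t ≠ 0) :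
    Tendsto (fun t => ⟪deriv (deriv (f ∘ γ)) t, ν (γ t)⟫ / ‖deriv (f ∘ γ) t‖ ^ 2)
      (nhdsWithin 0 {0}ᶜ) (nhds ⟪pu (pu f) p, ν p⟫) := by
  have hγt : Tendsto γ (nhds 0) (nhds p) := hγ0 ▸ hγ.continuous.tendsto 0
  have hball : ∀ᶠ t : ℝ in nhds 0, |t| < δ :=
    continuous_abs.continuousAt.eventually_lt_const (by simpa using hδ)
  have hlim : Tendsto (fun t => ⟪pu (pu f) (γ t), ν (γ t)⟫) (nhdsWithin 0 {0}ᶜ)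
      (nhds ⟪pu (pu f) p, ν p⟫) := by
    have hcont : Continuous fun q => ⟪pu (pu f) q, ν q⟫ :=
      (contDiff_fderiv_apply_const (contDiff_fderiv_apply_const hf _) _).continuous.inner
        hν.continuous
    exact ((hcont.tendsto p).comp hγt).mono_left nhdsWithin_le_nhds
  refine hlim.congr' ?_
  filter_upwards [nhdsWithin_le_nhds (hγt.eventually hfrontal.eventually_nhds),
    nhdsWithin_le_nhds hball.eventually_nhds, self_mem_nhdsWithin] with t hfr hnear ht
  have hvel : deriv (f ∘ γ) t = (deriv γ t).1 • pu f (γ t) :=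
    deriv_comp_eq_smul_pu (hf.differentiable (by simp) _) (hγ.differentiable (by simp) _)
      (hsing t hnear.self_of_nhds)
  have hspeed : (deriv γ t).1 ≠ 0 := by
    intro h0
    exact hreg t ht hnear.self_of_nhds (by rw [hvel, h0, zero_smul])
  rw [inner_deriv_deriv_comp_eq hf (hν.differentiable (by simp) _) hγ hfr.self_of_nhds.2.1
      (hfr.mono fun _ h => h.2.2) (hnear.mono hsing),
    hvel, norm_smul, hunit t hnear.self_of_nhds, mul_one, Real.norm_eq_abs, sq_abs,
    mul_div_cancel_left₀ _ (pow_ne_zero 2 hspeed)]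
end
end

section
/- Let f and ν be as in the context, and suppose p = (0,0) is a singular point of the first kind in the sense that f_v(u,0) = 0 for all u near 0 (so the u-axis is the singular curve with null direction ∂_v) and f_u(0,0) ≠ 0. Then f is a front at p (i.e. ∂_v ν(0,0) ≠ 0) if and only if ψ_ccr(0) ≠ 0, where ψ_ccr(u) := det(f_u(u,0), ν(u,0), ∂_v ν(u,0)). -/
open scoped RealInnerProductSpace
open Filter

noncomputable section

/-- The square of the determinant of three vectors is their Gram determinant. -/
lemma det3_sq (a b c : E3) :
    det3 a b c ^ 2 = ⟪a, a⟫ * ⟪b, b⟫ * ⟪c, c⟫ + 2 * ⟪a, b⟫ * ⟪b, c⟫ * ⟪a, c⟫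
      - ⟪a, a⟫ * ⟪b, c⟫ ^ 2 - ⟪b, b⟫ * ⟪a, c⟫ ^ 2 - ⟪c, c⟫ * ⟪a, b⟫ ^ 2 := by
  simp only [det3, Matrix.det_fin_three, PiLp.inner_apply, Fin.sum_univ_three, Matrix.of_apply,
    Matrix.cons_val, RCLike.inner_apply, conj_trivial]
  ring

/-- Three pairwise orthogonal vectors, the first two nonzero, are linearly dependent only if the
third vanishes. -/
lemma det3_eq_zero_iff_of_orthogonal {a b c : E3} (ha : a ≠ 0) (hb : b ≠ 0)
    (hab : ⟪a, b⟫ = 0) (hbc : ⟪b, c⟫ = 0) (hac : ⟪a, c⟫ = 0) :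
    det3 a b c = 0 ↔ c = 0 := by
  rw [← sq_eq_zero_iff, det3_sq, hab, hbc, hac]
  simp [ha, hb]

lemma pv_inner {F : Type*} [NormedAddCommGroup F] [InnerProductSpace ℝ F] {g h : ℝ × ℝ → F}
    {q : ℝ × ℝ} (hg : DifferentiableAt ℝ g q) (hh : DifferentiableAt ℝ h q) :
    pv (fun x => ⟪g x, h x⟫) q = ⟪g q, pv h q⟫ + ⟪pv g q, h q⟫ :=
  fderiv_inner_apply ℝ hg hh _

lemma pv_eq_zero_of_eventuallyEq_const {F : Type*} [NormedAddCommGroup F] [NormedSpace ℝ F]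
    {g : ℝ × ℝ → F} {q : ℝ × ℝ} {c : F} (h : g =ᶠ[nhds q] fun _ => c) : pv g q = 0 := by
  simp [pv, h.fderiv_eq]

lemma pv_pu_comm {F : Type*} [NormedAddCommGroup F] [NormedSpace ℝ F] {f : ℝ × ℝ → F}
    (hf : ContDiff ℝ 2 f) (q : ℝ × ℝ) : pv (pu f) q = pu (pv f) q := by
  have hd : DifferentiableAt ℝ (fderiv ℝ f) q :=
    (hf.fderiv_right (m := 1) (by norm_num)).differentiable (by norm_num) q
  have hsymm : IsSymmSndFDerivAt ℝ f q := hf.contDiffAt.isSymmSndFDerivAt (by simp)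
  have key (w w' : ℝ × ℝ) :
      fderiv ℝ (fun x => fderiv ℝ f x w) q w' = fderiv ℝ (fderiv ℝ f) q w' w := by
    rw [fderiv_clm_apply hd (differentiableAt_const w)]
    simp
  exact (key _ _).trans ((hsymm _ _).trans (key _ _).symm)

lemma pu_eq_zero_of_eventually_eq_zero {F : Type*} [NormedAddCommGroup F] [NormedSpace ℝ F]
    {g : ℝ × ℝ → F} {u v : ℝ} (hg : DifferentiableAt ℝ g (u, v))
    (h : ∀ᶠ x in nhds u, g (x, v) = 0) : pu g (u, v) = 0 := by
  have hline : HasDerivAt (fun x : ℝ => (x, v)) ((1, 0) : ℝ × ℝ) u :=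
    (hasDerivAt_id u).prodMk (hasDerivAt_const u v)
  have hcomp : HasDerivAt (fun x => g (x, v)) (pu g (u, v)) u :=
    hg.hasFDerivAt.comp_hasDerivAt u hline
  exact hcomp.unique ((hasDerivAt_const u (0 : F)).congr_of_eventuallyEq h)

/-- A frontal `f` which is singular of the first kind along the `u`-axis is a front at the
origin (i.e. `ν_v(0,0) ≠ 0`) if and only if `ψ_ccr(0) = det(f_u, ν, ν_v)(0,0) ≠ 0`. -/
theorem front_iff_psi_ccr_ne_zero
    (f ν : ℝ × ℝ → E3)
    (hf : ContDiff ℝ (⊤ : ℕ∞) f) (hν : ContDiff ℝ (⊤ : ℕ∞) ν)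
    (hfrontal : ∀ᶠ q in nhds ((0, 0) : ℝ × ℝ),
      ‖ν q‖ = 1 ∧ ⟪ν q, pu f q⟫ = 0 ∧ ⟪ν q, pv f q⟫ = 0)
    (hsing : ∀ᶠ u in nhds (0 : ℝ), pv f (u, 0) = 0)
    (hrank1 : pu f (0, 0) ≠ 0) :
    pv ν (0, 0) ≠ 0 ↔ det3 (pu f (0, 0)) (ν (0, 0)) (pv ν (0, 0)) ≠ 0 := by
  have hf2 : ContDiff ℝ 2 f := contDiff_infty.mp hf 2
  have hdf : ContDiff ℝ 1 (fderiv ℝ f) := hf2.fderiv_right (by norm_num)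
  have hdpu : DifferentiableAt ℝ (pu f) (0, 0) :=
    (hdf.clm_apply contDiff_const).differentiable (by norm_num) _
  have hdpv : DifferentiableAt ℝ (pv f) (0, 0) :=
    (hdf.clm_apply contDiff_const).differentiable (by norm_num) _
  have hdν : DifferentiableAt ℝ ν (0, 0) := hν.differentiable (by simp) _
  obtain ⟨hnorm, horth, -⟩ := hfrontal.self_of_nhds
  have hmixed : pv (pu f) (0, 0) = 0 := by
    rw [pv_pu_comm hf2, pu_eq_zero_of_eventually_eq_zero hdpv hsing]
  have hν_νv : ⟪ν (0, 0), pv ν (0, 0)⟫ = 0 := by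
    have h := pv_inner hdν hdν
    rw [pv_eq_zero_of_eventuallyEq_const (c := 1) (hfrontal.mono fun q hq => by
      simp [hq.1]), real_inner_comm (ν (0, 0)) (pv ν (0, 0))] at h
    linarith
  have hfu_νv : ⟪pu f (0, 0), pv ν (0, 0)⟫ = 0 := by
    have h := pv_inner hdν hdpu
    rw [pv_eq_zero_of_eventuallyEq_const (c := 0) (hfrontal.mono fun q hq => hq.2.1), hmixed,
      inner_zero_right, zero_add] at h
    rw [real_inner_comm, ← h]
  have hν0 : ν (0, 0) ≠ 0 := norm_ne_zero_iff.mp (by simp [hnorm])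
  exact (det3_eq_zero_iff_of_orthogonal hrank1 hν0 (by rw [real_inner_comm, horth])
    hν_νv hfu_νv).not.symm
end
end

section
/- Let f and ν satisfy the adapted coordinate conditions at the first-kind singular point p = (0,0) as in the context. Then there exists a C^∞ function Ĥ on a neighborhood of p such that Ĥ(u,v) = v·H(u,v) at every point with v ≠ 0 (where H is the mean curvature), and 4·Ĥ(u,0) = κ_c(u) for all u near 0, where κ_c(u) := det(f_u(u,0), f_vv(u,0), f_vvv(u,0)) is the cuspidal curvature. -/
open scoped RealInnerProductSpace
open Filter

noncomputable section

/-- Coefficients of the first fundamental form. -/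
def Ec (f : ℝ × ℝ → E3) (q : ℝ × ℝ) : ℝ := ⟪pu f q, pu f q⟫
def Fc (f : ℝ × ℝ → E3) (q : ℝ × ℝ) : ℝ := ⟪pu f q, pv f q⟫
def Gc (f : ℝ × ℝ → E3) (q : ℝ × ℝ) : ℝ := ⟪pv f q, pv f q⟫

/-- Coefficients of the second fundamental form. -/
def Lc (f ν : ℝ × ℝ → E3) (q : ℝ × ℝ) : ℝ := ⟪pu (pu f) q, ν q⟫
def Mc (f ν : ℝ × ℝ → E3) (q : ℝ × ℝ) : ℝ := ⟪pv (pu f) q, ν q⟫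
def Nc (f ν : ℝ × ℝ → E3) (q : ℝ × ℝ) : ℝ := ⟪pv (pv f) q, ν q⟫

/-- The mean curvature `H = (E N − 2 F M + G L)/(2(E G − F²))`. -/
def meanCurv (f ν : ℝ × ℝ → E3) (q : ℝ × ℝ) : ℝ :=
  (Ec f q * Nc f ν q - 2 * Fc f q * Mc f ν q + Gc f q * Lc f ν q) /
    (2 * (Ec f q * Gc f q - Fc f q ^ 2))

/-- The Gaussian curvature `K = (L N − M²)/(E G − F²)`. -/
def gaussCurv (f ν : ℝ × ℝ → E3) (q : ℝ × ℝ) : ℝ :=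
  (Lc f ν q * Nc f ν q - Mc f ν q ^ 2) / (Ec f q * Gc f q - Fc f q ^ 2)

section PartialDerivatives

variable {E : Type*} [NormedAddCommGroup E] [NormedSpace ℝ E]

theorem contDiff_pu {g : ℝ × ℝ → E} (hg : ContDiff ℝ (⊤ : ℕ∞) g) :
    ContDiff ℝ (⊤ : ℕ∞) (pu g) :=
  (contDiff_infty_iff_fderiv.1 hg).2.clm_apply contDiff_const

theorem contDiff_pv {g : ℝ × ℝ → E} (hg : ContDiff ℝ (⊤ : ℕ∞) g) :
    ContDiff ℝ (⊤ : ℕ∞) (pv g) :=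
  (contDiff_infty_iff_fderiv.1 hg).2.clm_apply contDiff_const

theorem pv_pu_eq_pu_pv_s5 {g : ℝ × ℝ → E} (hg : ContDiff ℝ (⊤ : ℕ∞) g) (q : ℝ × ℝ) :
    pv (pu g) q = pu (pv g) q := by
  have hd : DifferentiableAt ℝ (fderiv ℝ g) q :=
    (contDiff_infty_iff_fderiv.1 (contDiff_infty_iff_fderiv.1 hg).2).1 q
  have hs : IsSymmSndFDerivAt ℝ g q := hg.contDiffAt.isSymmSndFDerivAt (by simpa using ENat.LEInfty.out)
  have key (w z : ℝ × ℝ) :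
      fderiv ℝ (fun p => fderiv ℝ g p w) q z = fderiv ℝ (fderiv ℝ g) q z w := by
    simp [fderiv_clm_apply hd (differentiableAt_const w)]
  change fderiv ℝ (fun p => fderiv ℝ g p (1, 0)) q (0, 1)
    = fderiv ℝ (fun p => fderiv ℝ g p (0, 1)) q (1, 0)
  rw [key, key, hs.eq]

theorem pu_congr {g h : ℝ × ℝ → E} {q : ℝ × ℝ} (hgh : g =ᶠ[nhds q] h) : pu g q = pu h q := by
  rw [pu, pu, hgh.fderiv_eq]

theorem pv_congr {g h : ℝ × ℝ → E} {q : ℝ × ℝ} (hgh : g =ᶠ[nhds q] h) : pv g q = pv h q := by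
  rw [pv, pv, hgh.fderiv_eq]

theorem pu_snd_smul {h : ℝ × ℝ → E} {q : ℝ × ℝ} (hh : DifferentiableAt ℝ h q) :
    pu (fun p => p.2 • h p) q = q.2 • pu h q := by
  simp [pu, fderiv_fun_smul differentiableAt_snd hh, fderiv_snd]

theorem pv_snd_smul {h : ℝ × ℝ → E} {q : ℝ × ℝ} (hh : DifferentiableAt ℝ h q) :
    pv (fun p => p.2 • h p) q = h q + q.2 • pv h q := by
  simp [pv, fderiv_fun_smul differentiableAt_snd hh, fderiv_snd, add_comm]

theorem pv_add {g h : ℝ × ℝ → E} {q : ℝ × ℝ} (hg : DifferentiableAt ℝ g q)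
    (hh : DifferentiableAt ℝ h q) : pv (fun p => g p + h p) q = pv g q + pv h q := by
  simp [pv, fderiv_fun_add hg hh]

end PartialDerivatives

/-- Integrating a `C^n` function over a compact interval in its last variable gives a `C^n`
function of the remaining variables. -/
theorem contDiff_intervalIntegral_of_contDiff.{u} {H : Type u} [NormedAddCommGroup H] [NormedSpace ℝ H]
    [ProperSpace H] (a b : ℝ) (n : ℕ) :
    ∀ {E : Type u} [NormedAddCommGroup E] [NormedSpace ℝ E] [CompleteSpace E]
      {φ : H × ℝ → E}, ContDiff ℝ n φ → ContDiff ℝ n fun x => ∫ t in a..b, φ (x, t) := by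
  induction n with
  | zero =>
    intro E _ _ _ φ hφ
    rw [Nat.cast_zero, contDiff_zero] at hφ ⊢
    exact intervalIntegral.continuous_parametric_intervalIntegral_of_continuous'
      (f := fun x t => φ (x, t)) hφ a b
  | succ n ih =>
    intro E _ _ _ φ hφ
    rw [Nat.cast_succ] at hφ ⊢
    have hφ' : ContDiff ℝ n fun q => (fderiv ℝ φ q).comp (ContinuousLinearMap.inl ℝ H ℝ) :=
      (hφ.fderiv_right le_rfl).clm_comp contDiff_const
    have hderiv (x : H) : HasFDerivAt (fun x => ∫ t in a..b, φ (x, t))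
        (∫ t in a..b, (fderiv ℝ φ (x, t)).comp (ContinuousLinearMap.inl ℝ H ℝ)) x := by
      have hφc := hφ.continuous
      have hφc' := hφ'.continuous
      obtain ⟨C, hC⟩ := ((isCompact_closedBall x 1).prod
        (isCompact_uIcc (a := a) (b := b))).exists_bound_of_continuousOn hφc'.continuousOn
      refine intervalIntegral.hasFDerivAt_integral_of_dominated_of_fderiv_le
        (F' := fun x t => (fderiv ℝ φ (x, t)).comp (ContinuousLinearMap.inl ℝ H ℝ))
        (bound := fun _ => C) (Metric.closedBall_mem_nhds x one_pos) ?_ ?_ ?_ ?_ ?_ ?_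
      · exact .of_forall fun y =>
          (hφc.comp (Continuous.prodMk_right y)).aestronglyMeasurable
      · exact (hφc.comp (Continuous.prodMk_right x)).intervalIntegrable _ _
      · exact (hφc'.comp (Continuous.prodMk_right x)).aestronglyMeasurable
      · exact .of_forall fun t ht y hy => hC (y, t) ⟨hy, Set.uIoc_subset_uIcc ht⟩
      · exact intervalIntegrable_const
      · refine .of_forall fun t _ y _ => ?_
        exact (hφ.differentiable (by simp) (y, t)).hasFDerivAt.comp y (hasFDerivAt_prodMk_left y t)
    rw [contDiff_succ_iff_fderiv]
    refine ⟨fun x => (hderiv x).differentiableAt, by simp, ?_⟩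
    rw [funext fun x => (hderiv x).fderiv]
    exact ih hφ'

/-- Hadamard's lemma in the second variable. -/
theorem exists_contDiff_eq_add_smul {E : Type} [NormedAddCommGroup E] [NormedSpace ℝ E]
    [CompleteSpace E] {g : ℝ × ℝ → E} (hg : ContDiff ℝ (⊤ : ℕ∞) g) :
    ∃ h : ℝ × ℝ → E, ContDiff ℝ (⊤ : ℕ∞) h ∧ ∀ q, g q = g (q.1, 0) + q.2 • h q := by
  have hpv := contDiff_pv hg
  refine ⟨fun q => ∫ t in (0 : ℝ)..1, pv g (q.1, t * q.2), ?_, fun q => ?_⟩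
  · rw [contDiff_infty]
    intro n
    refine contDiff_intervalIntegral_of_contDiff 0 1 n
      (φ := fun p : (ℝ × ℝ) × ℝ => pv g (p.1.1, p.2 * p.1.2)) ?_
    exact (contDiff_infty.1 hpv n).comp (by fun_prop)
  · have hd (t : ℝ) : HasDerivAt (fun t => g (q.1, t * q.2)) (q.2 • pv g (q.1, t * q.2)) t := by
      have h1 : HasDerivAt (fun t : ℝ => (q.1, t * q.2)) ((0 : ℝ), q.2) t :=
        (hasDerivAt_const t q.1).prodMk (by simpa using (hasDerivAt_id t).mul_const q.2)
      have h2 := ((contDiff_infty_iff_fderiv.1 hg).1 (q.1, t * q.2)).hasFDerivAt.comp_hasDerivAt t h1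
      have h3 : q.2 • pv g (q.1, t * q.2) = fderiv ℝ g (q.1, t * q.2) (0, q.2) := by
        rw [pv, ← map_smul]
        simp
      rwa [h3]
    have hc : Continuous fun t : ℝ => q.2 • pv g (q.1, t * q.2) := by
      have := hpv.continuous
      fun_prop
    have := intervalIntegral.integral_eq_sub_of_hasDerivAt (fun t _ => hd t)
      (hc.intervalIntegrable 0 1)
    rw [intervalIntegral.integral_smul] at this
    simp [this]

theorem inner_cross3_eq_det3 (a b c : E3) : ⟪c, cross3 a b⟫ = det3 a b c := by
  simp [PiLp.inner_apply, Fin.sum_univ_three, cross3, det3, Matrix.det_fin_three]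
  ring

/-- In adapted coordinates at a singular point of the first kind, `v·H` extends to a smooth
function `Ĥ`, and along the singular curve `4 Ĥ(u,0)` equals the cuspidal curvature
`κ_c(u) = det(f_u, f_vv, f_vvv)(u,0)`. -/
theorem mean_curvature_times_v_extends_and_equals_cuspidal_curvature
    (f ν : ℝ × ℝ → E3)
    (hf : ContDiff ℝ (⊤ : ℕ∞) f) (hν : ContDiff ℝ (⊤ : ℕ∞) ν)
    (hfrontal : ∀ q : ℝ × ℝ, ‖ν q‖ = 1 ∧ ⟪ν q, pu f q⟫ = 0 ∧ ⟪ν q, pv f q⟫ = 0)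
    (hadapted : ∀ᶠ u in nhds (0 : ℝ),
      pv f (u, 0) = 0 ∧ ‖pu f (u, 0)‖ = 1 ∧
      ⟪pu f (u, 0), pv (pv f) (u, 0)⟫ = 0 ∧ ‖pv (pv f) (u, 0)‖ = 1 ∧
      ν (u, 0) = cross3 (pu f (u, 0)) (pv (pv f) (u, 0)))
    (hreg : ∀ᶠ q in nhds ((0, 0) : ℝ × ℝ), q.2 ≠ 0 → Ec f q * Gc f q - Fc f q ^ 2 ≠ 0) :
    ∃ (W : Set (ℝ × ℝ)) (Hhat : ℝ × ℝ → ℝ), IsOpen W ∧ (0, 0) ∈ W ∧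
      ContDiffOn ℝ (⊤ : ℕ∞) Hhat W ∧
      (∀ q ∈ W, q.2 ≠ 0 → Hhat q = q.2 * meanCurv f ν q) ∧
      (∀ u : ℝ, (u, 0) ∈ W →
        4 * Hhat (u, 0) =
          det3 (pu f (u, 0)) (pv (pv f) (u, 0)) (pv (pv (pv f)) (u, 0))) := by
  obtain ⟨U, hU, hUo, h0U⟩ := eventually_nhds_iff.1 hadapted
  obtain ⟨h, hh, hgh⟩ := exists_contDiff_eq_add_smul (contDiff_pv hf)
  have hhd : Differentiable ℝ h := (contDiff_infty_iff_fderiv.1 hh).1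
  have hhvd : Differentiable ℝ (pv h) := (contDiff_infty_iff_fderiv.1 (contDiff_pv hh)).1
  let S : Set (ℝ × ℝ) := Prod.fst ⁻¹' U
  have hSo : IsOpen S := hUo.preimage continuous_fst
  have hv : ∀ q ∈ S, pv f q = q.2 • h q := fun q hq => by
    rw [hgh q, (hU q.1 hq).1, zero_add]
  have hv_near {q} (hq : q ∈ S) : pv f =ᶠ[nhds q] fun p => p.2 • h p :=
    eventually_of_mem (hSo.mem_nhds hq) hv
  have huv : ∀ q ∈ S, pv (pu f) q = q.2 • pu h q := fun q hq => by
    rw [pv_pu_eq_pu_pv_s5 hf, pu_congr (hv_near hq), pu_snd_smul (hhd q)]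
  have hvv : ∀ q ∈ S, pv (pv f) q = h q + q.2 • pv h q := fun q hq => by
    rw [pv_congr (hv_near hq), pv_snd_smul (hhd q)]
  have hvvv : ∀ q ∈ S, pv (pv (pv f)) q = pv h q + (pv h q + q.2 • pv (pv h) q) :=
    fun q hq => by
      rw [pv_congr (eventually_of_mem (hSo.mem_nhds hq) hvv),
        pv_add (hhd q) (differentiableAt_snd.fun_smul (hhvd q)), pv_snd_smul (hhvd q)]
  let D : ℝ × ℝ → ℝ := fun q => ⟪pu f q, pu f q⟫ * ⟪h q, h q⟫ - ⟪pu f q, h q⟫ ^ 2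
  have hcu := contDiff_pu hf
  have hD : ContDiff ℝ (⊤ : ℕ∞) D :=
    ((hcu.inner ℝ hcu).mul (hh.inner ℝ hh)).sub ((hcu.inner ℝ hh).pow 2)
  have hD0 : ∀ u ∈ U, D (u, 0) = 1 := fun u hu => by
    obtain ⟨-, h1, h2, h3, -⟩ := hU u hu
    have e := hvv (u, 0) hu
    simp only [zero_smul, add_zero] at e
    rw [e] at h2 h3
    simp [D, h1, h2, h3]
  refine ⟨S ∩ {q | D q ≠ 0}, fun q =>
    (⟪pu f q, pu f q⟫ * ⟪pv h q, ν q⟫ - 2 * q.2 * (⟪pu f q, h q⟫ * ⟪pu h q, ν q⟫)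
      + q.2 * (⟪h q, h q⟫ * ⟪pu (pu f) q, ν q⟫)) / (2 * D q),
    hSo.inter (isOpen_ne_fun hD.continuous continuous_const), ⟨h0U, by simp [hD0 0 h0U]⟩,
    ?_, ?_, ?_⟩
  · have hsnd : ContDiff ℝ (⊤ : ℕ∞) fun q : ℝ × ℝ => q.2 := contDiff_snd
    refine ContDiffOn.div (ContDiff.contDiffOn ?_) (contDiff_const.mul hD).contDiffOn
      fun q hq => mul_ne_zero two_ne_zero hq.2
    exact (((hcu.inner ℝ hcu).mul ((contDiff_pv hh).inner ℝ hν)).sub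
      ((contDiff_const.mul hsnd).mul ((hcu.inner ℝ hh).mul ((contDiff_pu hh).inner ℝ hν)))).add
      (hsnd.mul ((hh.inner ℝ hh).mul ((contDiff_pu hcu).inner ℝ hν)))
  · rintro q ⟨hqS, hqD⟩ hq
    have hn : ⟪h q, ν q⟫ = 0 := by
      have := (hfrontal q).2.2
      rw [hv q hqS, real_inner_smul_right, real_inner_comm] at this
      exact (mul_eq_zero.1 this).resolve_left hq
    simp only [meanCurv, Ec, Fc, Gc, Lc, Mc, Nc, hv q hqS, huv q hqS, hvv q hqS,
      real_inner_smul_left, real_inner_smul_right, inner_add_left, hn]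
    have hden : ⟪pu f q, pu f q⟫ * (q.2 * (q.2 * ⟪h q, h q⟫)) - (q.2 * ⟪pu f q, h q⟫) ^ 2
        = q.2 ^ 2 * D q := by
      simp only [D]
      ring
    rw [hden]
    have hqD' : D q ≠ 0 := hqD
    field_simp
    ring
  · rintro u ⟨huS, -⟩
    obtain ⟨-, h1, -, -, h5⟩ := hU u huS
    rw [← inner_cross3_eq_det3, ← h5, hvvv _ huS]
    simp [hD0 u huS, h1, inner_add_left]
    ring
end
end

section
/- Let f and ν satisfy the adapted coordinate conditions at the first-kind singular point p = (0,0) as in the context, and assume moreover that f is a front along the singular curve, i.e. ∂_v ν(u,0) ≠ 0 for all u near 0 (so each (u,0) is a cuspidal edge). Then the Gaussian curvature K is bounded on the set of regular points in some neighborhood of p if and only if the limiting normal curvature κ_ν(u) := ⟨f_uu(u,0), ν(u,0)⟩ vanishes for all u near 0. -/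
open scoped RealInnerProductSpace
open Filter

noncomputable section

lemma contDiff_pu_s11 {E : Type*} [NormedAddCommGroup E] [NormedSpace ℝ E] {f : ℝ × ℝ → E}
    (hf : ContDiff ℝ (⊤ : ℕ∞) f) : ContDiff ℝ (⊤ : ℕ∞) (pu f) :=
  (hf.fderiv_right (m := (⊤ : ℕ∞)) (by simp)).clm_apply contDiff_const

lemma contDiff_pv_s11 {E : Type*} [NormedAddCommGroup E] [NormedSpace ℝ E] {f : ℝ × ℝ → E}
    (hf : ContDiff ℝ (⊤ : ℕ∞) f) : ContDiff ℝ (⊤ : ℕ∞) (pv f) :=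
  (hf.fderiv_right (m := (⊤ : ℕ∞)) (by simp)).clm_apply contDiff_const

lemma pu_pv_eq_pv_pu {E : Type*} [NormedAddCommGroup E] [NormedSpace ℝ E] {f : ℝ × ℝ → E}
    (hf : ContDiff ℝ (⊤ : ℕ∞) f) (q : ℝ × ℝ) : pu (pv f) q = pv (pu f) q := by
  have hd : DifferentiableAt ℝ (fderiv ℝ f) q :=
    ((hf.fderiv_right (m := (⊤ : ℕ∞)) (by simp)).differentiable (by simp)) q
  have hsymm : IsSymmSndFDerivAt ℝ f q := hf.contDiffAt.isSymmSndFDerivAt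
    (by simpa using (WithTop.coe_le_coe.2 le_top : ((2 : ℕ∞) : WithTop ℕ∞) ≤ (⊤ : ℕ∞)))
  have key : ∀ a b : ℝ × ℝ, fderiv ℝ (fun x => fderiv ℝ f x a) q b
      = fderiv ℝ (fderiv ℝ f) q b a := by
    intro a b
    rw [fderiv_clm_apply hd (differentiableAt_const a)]
    simp
  change fderiv ℝ (fun x => fderiv ℝ f x (0, 1)) q (1, 0)
    = fderiv ℝ (fun x => fderiv ℝ f x (1, 0)) q (0, 1)
  rw [key, key]
  exact hsymm.eq _ _

/-- Differentiating an identically vanishing inner product. -/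
lemma inner_fderiv_add_inner_fderiv_eq_zero {E F : Type*} [NormedAddCommGroup E]
    [NormedSpace ℝ E] [NormedAddCommGroup F] [InnerProductSpace ℝ F] {a b : E → F}
    (ha : Differentiable ℝ a) (hb : Differentiable ℝ b) {c : ℝ} (h : ∀ q, ⟪a q, b q⟫ = c)
    (q w : E) : ⟪a q, fderiv ℝ b q w⟫ + ⟪fderiv ℝ a q w, b q⟫ = 0 := by
  rw [← fderiv_inner_apply ℝ (ha q) (hb q), funext h]
  simp

/-- A vector orthogonal to `a`, `b` and the unit vector `a × b` vanishes. -/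
lemma eq_zero_of_inner_eq_zero_of_inner_cross3_eq_zero {a b w : E3} (hn : ‖cross3 a b‖ = 1)
    (ha : ⟪w, a⟫ = 0) (hb : ⟪w, b⟫ = 0) (hc : ⟪w, cross3 a b⟫ = 0) : w = 0 := by
  have hn2 : ⟪cross3 a b, cross3 a b⟫ = 1 := by
    rw [real_inner_self_eq_norm_sq, hn, one_pow]
  simp only [cross3, PiLp.inner_apply, Fin.sum_univ_three, RCLike.inner_apply, conj_trivial,
    WithLp.equiv_symm_apply, Matrix.cons_val_zero, Matrix.cons_val_one,
    Matrix.cons_val] at hn2 ha hb hc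
  set n0 := a 1 * b 2 - a 2 * b 1 with h0
  set n1 := a 2 * b 0 - a 0 * b 2 with h1
  set n2 := a 0 * b 1 - a 1 * b 0 with h2
  ext i
  fin_cases i
  · change w 0 = 0
    linear_combination (-w 0) * hn2 + n0 * hc + (n1 * a 2 - n2 * a 1) * hb
      - (n1 * b 2 - n2 * b 1) * ha
  · change w 1 = 0
    linear_combination (-w 1) * hn2 + n1 * hc + (n2 * a 0 - n0 * a 2) * hb
      - (n2 * b 0 - n0 * b 2) * ha
  · change w 2 = 0
    linear_combination (-w 2) * hn2 + n2 * hc + (n0 * a 1 - n1 * a 0) * hb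
      - (n0 * b 1 - n1 * b 0) * ha

/-- The filter of points off the `u`-axis tending to `(u, 0)`. -/
def offAxis (u : ℝ) : Filter (ℝ × ℝ) := nhdsWithin (u, 0) {q | q.2 ≠ 0}

lemma offAxis_neBot (u : ℝ) : (offAxis u).NeBot := by
  have h : Tendsto (fun v : ℝ => (u, v)) (nhdsWithin 0 {0}ᶜ) (offAxis u) := by
    refine tendsto_nhdsWithin_iff.2 ⟨?_, ?_⟩
    · exact (Continuous.tendsto (by fun_prop) 0).mono_left nhdsWithin_le_nhds
    · filter_upwards [self_mem_nhdsWithin] with v hv using hv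
  exact h.neBot

/-- If `g` vanishes on the `u`-axis, then `g / v` tends to `∂g/∂v` on the axis. -/
lemma tendsto_inv_smul_offAxis {E : Type*} [NormedAddCommGroup E] [NormedSpace ℝ E]
    {g : ℝ × ℝ → E} {u : ℝ} (hg : ContDiffAt ℝ 1 g (u, 0))
    (h0 : ∀ᶠ s in nhds u, g (s, 0) = 0) :
    Tendsto (fun q : ℝ × ℝ => q.2⁻¹ • g q) (offAxis u) (nhds (pv g (u, 0))) := by
  have hs := (hg.hasStrictFDerivAt one_ne_zero).isLittleO
  have hproj : Tendsto (fun q : ℝ × ℝ => (q, (q.1, (0 : ℝ)))) (offAxis u)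
      (nhds ((u, 0), (u, 0))) :=
    (Continuous.tendsto' (by fun_prop) _ _ (by simp)).mono_left nhdsWithin_le_nhds
  have h1 := hs.comp_tendsto hproj
  have h0' : ∀ᶠ q : ℝ × ℝ in offAxis u, g (q.1, 0) = 0 :=
    ((continuous_fst.tendsto (u, (0 : ℝ))).mono_left nhdsWithin_le_nhds).eventually h0
  have hne : ∀ᶠ q : ℝ × ℝ in offAxis u, q.2 ≠ 0 := self_mem_nhdsWithin
  rw [Metric.tendsto_nhds]
  intro ε hε
  filter_upwards [h1.bound (half_pos hε), h0', hne] with q hq hq0 hv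
  have e1 : q - (q.1, 0) = q.2 • ((0, 1) : ℝ × ℝ) := by ext <;> simp
  simp only [Function.comp_apply, hq0, e1, map_smul, sub_zero, norm_smul, Prod.norm_mk,
    norm_zero, norm_one] at hq
  have e2 : q.2⁻¹ • g q - pv g (u, 0) = q.2⁻¹ • (g q - q.2 • pv g (u, 0)) := by
    rw [smul_sub, smul_smul, inv_mul_cancel₀ hv, one_smul]
  rw [dist_eq_norm, e2, norm_smul, norm_inv]
  have hpos : 0 < ‖q.2‖ := norm_pos_iff.2 hv
  rw [inv_mul_lt_iff₀ hpos]
  refine lt_of_le_of_lt hq ?_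
  simp only [zero_le_one, sup_of_le_right, mul_one]
  nlinarith

lemma tendsto_offAxis {X : Type*} [TopologicalSpace X] {g : ℝ × ℝ → X} (hg : Continuous g)
    (u : ℝ) : Tendsto g (offAxis u) (nhds (g (u, 0))) :=
  (hg.tendsto _).mono_left nhdsWithin_le_nhds

section Frontal

variable {f ν : ℝ × ℝ → E3}

/-- The Weingarten form of `M`. -/
lemma Mc_eq_neg_inner (hf : ContDiff ℝ (⊤ : ℕ∞) f) (hν : ContDiff ℝ (⊤ : ℕ∞) ν)
    (h : ∀ q, ⟪ν q, pv f q⟫ = 0) (q : ℝ × ℝ) : Mc f ν q = -⟪pv f q, pu ν q⟫ := by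
  have := inner_fderiv_add_inner_fderiv_eq_zero (hν.differentiable (by simp))
    ((contDiff_pv_s11 hf).differentiable (by simp)) h q (1, 0)
  change ⟪ν q, pu (pv f) q⟫ + ⟪pu ν q, pv f q⟫ = 0 at this
  rw [pu_pv_eq_pv_pu hf, real_inner_comm (pv (pu f) q), real_inner_comm (pv f q)] at this
  unfold Mc
  linarith

/-- The Weingarten form of `N`. -/
lemma Nc_eq_neg_inner (hf : ContDiff ℝ (⊤ : ℕ∞) f) (hν : ContDiff ℝ (⊤ : ℕ∞) ν)
    (h : ∀ q, ⟪ν q, pv f q⟫ = 0) (q : ℝ × ℝ) : Nc f ν q = -⟪pv f q, pv ν q⟫ := by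
  have := inner_fderiv_add_inner_fderiv_eq_zero (hν.differentiable (by simp))
    ((contDiff_pv_s11 hf).differentiable (by simp)) h q (0, 1)
  change ⟪ν q, pv (pv f) q⟫ + ⟪pv ν q, pv f q⟫ = 0 at this
  rw [real_inner_comm (pv (pv f) q), real_inner_comm (pv f q)] at this
  unfold Nc
  linarith

/-- At a singular point of a front, `∂ν/∂v` has a nonzero component along `∂²f/∂v²`. -/
lemma inner_pv_pv_pv_ne_zero (hf : ContDiff ℝ (⊤ : ℕ∞) f) (hν : ContDiff ℝ (⊤ : ℕ∞) ν)
    (hfrontal : ∀ q : ℝ × ℝ, ‖ν q‖ = 1 ∧ ⟪ν q, pu f q⟫ = 0 ∧ ⟪ν q, pv f q⟫ = 0)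
    {q : ℝ × ℝ} (hpv : pv f q = 0) (hcross : ν q = cross3 (pu f q) (pv (pv f) q))
    (hfront : pv ν q ≠ 0) : ⟪pv (pv f) q, pv ν q⟫ ≠ 0 := by
  intro hc
  apply hfront
  have hνd := hν.differentiable (by simp)
  refine eq_zero_of_inner_eq_zero_of_inner_cross3_eq_zero (hcross ▸ (hfrontal q).1) ?_
    ((real_inner_comm _ _).trans hc) ?_
  · have h1 := inner_fderiv_add_inner_fderiv_eq_zero hνd
      ((contDiff_pu_s11 hf).differentiable (by simp)) (fun q => (hfrontal q).2.1) q (0, 1)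
    change ⟪ν q, pv (pu f) q⟫ + ⟪pv ν q, pu f q⟫ = 0 at h1
    have h2 := Mc_eq_neg_inner hf hν (fun q => (hfrontal q).2.2) q
    rw [hpv, inner_zero_left, neg_zero, Mc, real_inner_comm] at h2
    linarith
  · have h1 := inner_fderiv_add_inner_fderiv_eq_zero hνd hνd (c := 1)
      (fun q => by rw [real_inner_self_eq_norm_sq, (hfrontal q).1, one_pow]) q (0, 1)
    change ⟪ν q, pv ν q⟫ + ⟪pv ν q, ν q⟫ = 0 at h1
    rw [real_inner_comm] at h1
    rw [← hcross]
    linarith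

/-- The Gaussian curvature off the axis in terms of `h = f_v / v`. -/
lemma gaussCurv_eq_of_snd_ne_zero (hf : ContDiff ℝ (⊤ : ℕ∞) f) (hν : ContDiff ℝ (⊤ : ℕ∞) ν)
    (hfv : ∀ q, ⟪ν q, pv f q⟫ = 0) {q : ℝ × ℝ} (hq : q.2 ≠ 0) {h : E3}
    (hh : h = q.2⁻¹ • pv f q) :
    gaussCurv f ν q = (-(q.2⁻¹ * Lc f ν q * ⟪h, pv ν q⟫) - ⟪h, pu ν q⟫ ^ 2) /
      (Ec f q * ⟪h, h⟫ - ⟪pu f q, h⟫ ^ 2) := by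
  have e : pv f q = q.2 • h := by rw [hh, smul_smul, mul_inv_cancel₀ hq, one_smul]
  rw [gaussCurv, Mc_eq_neg_inner hf hν hfv, Nc_eq_neg_inner hf hν hfv, Fc, Gc, e]
  simp only [real_inner_smul_left, real_inner_smul_right]
  rw [← mul_div_mul_left _ (Ec f q * ⟪h, h⟫ - ⟪pu f q, h⟫ ^ 2) (pow_ne_zero 2 hq)]
  congr 1
  · field_simp
  · ring

end Frontal

/-- At a cuspidal edge (adapted coordinates, first kind, and `f` a front along the singular
curve), the Gaussian curvature is bounded on the regular points of some neighborhood of the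
origin if and only if the limiting normal curvature `κ_ν(u) = ⟨f_uu, ν⟩(u,0)` vanishes for
all `u` near `0`. -/
theorem gauss_curvature_bounded_iff_limiting_normal_curvature_vanishes
    (f ν : ℝ × ℝ → E3)
    (hf : ContDiff ℝ (⊤ : ℕ∞) f) (hν : ContDiff ℝ (⊤ : ℕ∞) ν)
    (hfrontal : ∀ q : ℝ × ℝ, ‖ν q‖ = 1 ∧ ⟪ν q, pu f q⟫ = 0 ∧ ⟪ν q, pv f q⟫ = 0)
    (hadapted : ∀ᶠ u in nhds (0 : ℝ),
      pv f (u, 0) = 0 ∧ ‖pu f (u, 0)‖ = 1 ∧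
      ⟪pu f (u, 0), pv (pv f) (u, 0)⟫ = 0 ∧ ‖pv (pv f) (u, 0)‖ = 1 ∧
      ν (u, 0) = cross3 (pu f (u, 0)) (pv (pv f) (u, 0)))
    (hreg : ∀ᶠ q in nhds ((0, 0) : ℝ × ℝ), q.2 ≠ 0 → Ec f q * Gc f q - Fc f q ^ 2 ≠ 0)
    (hfront : ∀ᶠ u in nhds (0 : ℝ), pv ν (u, 0) ≠ 0) :
    (∃ (W : Set (ℝ × ℝ)) (C : ℝ), IsOpen W ∧ (0, 0) ∈ W ∧
        ∀ q ∈ W, Ec f q * Gc f q - Fc f q ^ 2 ≠ 0 → |gaussCurv f ν q| ≤ C) ↔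
      (∀ᶠ u in nhds (0 : ℝ), ⟪pu (pu f) (u, 0), ν (u, 0)⟫ = 0) := by
  have hfv : ∀ q, ⟪ν q, pv f q⟫ = 0 := fun q => (hfrontal q).2.2
  have hpu := contDiff_pu_s11 hf
  have hpv := contDiff_pv_s11 hf
  have hLs : ContDiff ℝ (⊤ : ℕ∞) (Lc f ν) := (contDiff_pu_s11 hpu).inner ℝ hν
  let h : ℝ × ℝ → E3 := fun q => q.2⁻¹ • pv f q
  have hh : ∀ {u : ℝ}, (∀ᶠ s in nhds u, pv f (s, 0) = 0) →
      Tendsto h (offAxis u) (nhds (pv (pv f) (u, 0))) := fun h0 =>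
    tendsto_inv_smul_offAxis (hpv.contDiffAt.of_le (by simp)) h0
  have hne : ∀ u, ∀ᶠ q : ℝ × ℝ in offAxis u, q.2 ≠ 0 := fun u => self_mem_nhdsWithin
  have hden : ∀ {u : ℝ}, (∀ᶠ s in nhds u, pv f (s, 0) = 0) → ‖pu f (u, 0)‖ = 1 →
      ⟪pu f (u, 0), pv (pv f) (u, 0)⟫ = 0 → ‖pv (pv f) (u, 0)‖ = 1 →
      Tendsto (fun q => Ec f q * ⟪h q, h q⟫ - ⟪pu f q, h q⟫ ^ 2) (offAxis u) (nhds 1) := by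
    intro u h0 h1 h2 h3
    have ht := (((tendsto_offAxis hpu.continuous u).inner
      (tendsto_offAxis hpu.continuous u)).mul ((hh h0).inner (𝕜 := ℝ) (hh h0))).sub
      (((tendsto_offAxis hpu.continuous u).inner (𝕜 := ℝ) (hh h0)).pow 2)
    rw [h2, real_inner_self_eq_norm_sq, real_inner_self_eq_norm_sq, h1, h3] at ht
    simpa [Ec] using ht
  constructor
  · rintro ⟨W, C, hW, h0W, hK⟩
    have hWu : ∀ᶠ u : ℝ in nhds 0, (u, (0 : ℝ)) ∈ W :=
      (Continuous.tendsto' (by fun_prop) _ _ rfl : Tendsto (fun u : ℝ => (u, (0 : ℝ)))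
        (nhds 0) (nhds (0, 0))).eventually (hW.mem_nhds h0W)
    have hregu := (Continuous.tendsto' (by fun_prop) _ _ rfl : Tendsto
      (fun u : ℝ => (u, (0 : ℝ))) (nhds 0) (nhds (0, 0))).eventually hreg.eventually_nhds
    filter_upwards [hWu, hregu, hadapted, hadapted.eventually_nhds, hfront]
      with u hu hru ⟨ha1, ha2, ha3, ha4, ha5⟩ hae hfu
    have h0 : ∀ᶠ s in nhds u, pv f (s, 0) = 0 := hae.mono fun s hs => hs.1
    have hv0 : Tendsto (fun q : ℝ × ℝ => q.2) (offAxis u) (nhds 0) :=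
      tendsto_offAxis continuous_snd u
    have hlim : Tendsto (fun q => q.2 * gaussCurv f ν q) (offAxis u)
        (nhds ((-(Lc f ν (u, 0) * ⟪pv (pv f) (u, 0), pv ν (u, 0)⟫)
          - 0 * ⟪pv (pv f) (u, 0), pu ν (u, 0)⟫ ^ 2) / 1)) := by
      refine Tendsto.congr' ?_ (((((tendsto_offAxis hLs.continuous u).mul ((hh h0).inner
        (tendsto_offAxis (contDiff_pv_s11 hν).continuous u))).neg).sub
        (hv0.mul (((hh h0).inner (tendsto_offAxis (contDiff_pu_s11 hν).continuous u)).pow 2))).div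
        (hden h0 ha2 ha3 ha4) one_ne_zero)
      filter_upwards [hne u] with q hq
      rw [gaussCurv_eq_of_snd_ne_zero hf hν hfv hq (h := h q) rfl, mul_div_assoc']
      simp only [Pi.div_apply]
      congr 1
      field_simp
    have hlim0 : Tendsto (fun q => q.2 * gaussCurv f ν q) (offAxis u) (nhds 0) := by
      refine hv0.zero_mul_isBoundedUnder_le ⟨C, ?_⟩
      rw [eventually_map]
      filter_upwards [hne u, nhdsWithin_le_nhds (hW.mem_nhds hu), nhdsWithin_le_nhds hru]
        with q hq hqW hqr using hK q hqW (hqr hq)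
    have := offAxis_neBot u
    have heq := tendsto_nhds_unique hlim hlim0
    have hc := inner_pv_pv_pv_ne_zero hf hν hfrontal ha1 ha5 hfu
    simpa [hc, Lc] using heq
  · intro hL
    obtain ⟨-, ha2, ha3, ha4, -⟩ := hadapted.self_of_nhds
    have h0 : ∀ᶠ s in nhds (0 : ℝ), pv f (s, 0) = 0 := hadapted.mono fun s hs => hs.1
    have hlim := ((((tendsto_inv_smul_offAxis (hLs.contDiffAt.of_le (by simp)) hL).mul
      ((hh h0).inner (𝕜 := ℝ) (tendsto_offAxis (contDiff_pv_s11 hν).continuous 0))).neg).sub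
      (((hh h0).inner (𝕜 := ℝ) (tendsto_offAxis (contDiff_pu_s11 hν).continuous 0)).pow 2)).div
      (hden h0 ha2 ha3 ha4) one_ne_zero
    obtain ⟨C, hC⟩ := hlim.abs.isBoundedUnder_le
    rw [eventually_map, offAxis, eventually_nhdsWithin_iff] at hC
    have h0' : ∀ᶠ q : ℝ × ℝ in nhds (0, 0), pv f (q.1, 0) = 0 :=
      (continuous_fst.tendsto ((0 : ℝ), (0 : ℝ))).eventually h0
    obtain ⟨W, hWs, hW, h0W⟩ := eventually_nhds_iff.1 (hC.and h0')
    refine ⟨W, C, hW, h0W, fun q hq hqr => ?_⟩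
    obtain ⟨hb, hz⟩ := hWs q hq
    have hq2 : q.2 ≠ 0 := by
      intro hq2
      rw [← hq2] at hz
      exact hqr (by simp [Fc, Gc, hz])
    rw [gaussCurv_eq_of_snd_ne_zero hf hν hfv hq2 (h := h q) rfl]
    exact hb hq2
end
end
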